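/- Let G be a (1,1)-regular mixed graph (every vertex has undirected degree 1, directed in-degree 1, and directed out-degree 1) with diameter 3. Then G has at most 10 vertices. -/

import Mathlib

/-- `reachIn R n u v` : there is a walk of length exactly `n` from `u` to `v`
following the relation `R`. -/
def reachIn {V : Type*} (R : V → V → Prop) : ℕ → V → V → Prop
  | 0, u, v => u = v
  | n + 1, u, v => ∃ w, R u w ∧ reachIn R n w v

/-- A finite type with a fixed-point-free involution has even cardinality. -/
theorem even_card_of_involutive_of_forall_ne {V : Type*} [Fintype V] {f : V → V}
    (hf : Function.Involutive f) (hne : ∀ u, f u ≠ u) : Even (Fintype.card V) := by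
  rw [← ZMod.natCast_eq_zero_iff_even]
  have h : ∑ _u : V, (1 : ZMod 2) = 0 :=
    Finset.sum_involution (fun u _ => f u) (fun _ _ => by decide)
      (fun u _ _ => hne u) (fun _ _ => Finset.mem_univ _) (fun u _ => hf u)
  simpa using h

/-- If every vertex is reached from `u` in at most three steps along an involution `e` or a
map `a`, then there are at most eleven vertices. -/
theorem card_le_eleven_of_reachIn {V : Type*} [Fintype V] {e a : V → V}
    (he : Function.Involutive e) (u : V)
    (h : ∀ v, ∃ n ≤ 3, reachIn (fun x y => y = e x ∨ y = a x) n u v) :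
    Fintype.card V ≤ 11 := by
  classical
  let l : List V := [u, e u, a u, a (e u), e (a u), a (a u), e (a (e u)), a (a (e u)),
    a (e (a u)), e (a (a u)), a (a (a u))]
  have hl : (Finset.univ : Finset V) ⊆ l.toFinset := by
    intro v _
    obtain ⟨n, hn, hv⟩ := h v
    rw [List.mem_toFinset]
    interval_cases n <;> simp only [reachIn] at hv
    · simp [l, hv]
    · obtain ⟨_, rfl | rfl, rfl⟩ := hv <;> simp [l]
    · obtain ⟨_, rfl | rfl, _, rfl | rfl, rfl⟩ := hv <;> simp [l, he _]
    · obtain ⟨_, rfl | rfl, _, rfl | rfl, _, rfl | rfl, rfl⟩ := hv <;> simp [l, he _]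
  exact (Finset.card_le_card hl).trans (List.toFinset_card_le l)

/-- A (1,1)-regular mixed graph (every vertex has undirected
degree 1, out-degree 1 and in-degree 1) with diameter 3 has at most 10
vertices. -/
theorem stmt_16 {V : Type*} [Fintype V] [Nonempty V]
    (E A : V → V → Prop) (hE : Symmetric E)
    (hEloop : ∀ u : V, ¬ E u u)
    (hr : ∀ u : V, {v | E u v}.ncard = 1)
    (hzout : ∀ u : V, {v | A u v}.ncard = 1)
    (hzin : ∀ u : V, {v | A v u}.ncard = 1)
    (hdiam₃ : ∀ u v : V, ∃ n ≤ 3, reachIn (fun a b => E a b ∨ A a b) n u v)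
    (hdiam₃' : ∃ u v : V, ¬ ∃ n ≤ 2, reachIn (fun a b => E a b ∨ A a b) n u v) :
    Fintype.card V ≤ 10 := by
  choose e he using fun u => Set.ncard_eq_one.1 (hr u)
  choose a ha using fun u => Set.ncard_eq_one.1 (hzout u)
  have hEe (u v : V) : E u v ↔ v = e u := Set.ext_iff.1 (he u) v
  have hAa (u v : V) : A u v ↔ v = a u := Set.ext_iff.1 (ha u) v
  have hinv : Function.Involutive e := fun u =>
    ((hEe _ _).1 (hE ((hEe u _).2 rfl))).symm
  have hne (u : V) : e u ≠ u := fun h => hEloop u ((hEe u u).2 h.symm)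
  simp only [hEe, hAa] at hdiam₃
  obtain ⟨u⟩ := ‹Nonempty V›
  have hle := card_le_eleven_of_reachIn hinv u (hdiam₃ u)
  obtain ⟨k, hk⟩ := even_card_of_involutive_of_forall_ne hinv hne
  omega
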